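/- Let m ≥ n(n+1)/2. For every m-element frame {x_k}_{k=1}^m for ℝⁿ and every δ > 0, there exists an m-element frame {y_k}_{k=1}^m for ℝⁿ which is injective and satisfies Σ_{k=1}^m ‖x_k − y_k‖² < δ. That is, the injective m-element frames are dense in the m-element frames for ℝⁿ. -/

import Mathlib

open scoped InnerProductSpace

theorem aux_pert {n : ℕ} (T : EuclideanSpace ℝ (Fin n) →L[ℝ] EuclideanSpace ℝ (Fin n))
    (hT : IsSelfAdjoint T) (h0 : T ≠ 0) (x : EuclideanSpace ℝ (Fin n)) (ε : ℝ) (hε : 0 < ε) :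
    ∃ y, ‖x - y‖ < ε ∧ ⟪T y, y⟫_ℝ ≠ 0 := by
  by_contra! hc
  apply h0
  have hs : (T : EuclideanSpace ℝ (Fin n) →ₗ[ℝ] EuclideanSpace ℝ (Fin n)).IsSymmetric :=
    ContinuousLinearMap.isSelfAdjoint_iff_isSymmetric.mp hT
  have hsmall : ∀ v, ‖v‖ < ε → ⟪T v, v⟫_ℝ = 0 := by
    intro v hv
    have h1 := hc (x + v) (by simpa using hv)
    have h2 := hc (x - v) (by simpa using hv)
    have h3 := hc x (by simpa using hε)
    simp only [map_add, map_sub, inner_add_left, inner_add_right, inner_sub_left,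
      inner_sub_right] at h1 h2
    linarith
  have hall : ∀ v, ⟪T v, v⟫_ℝ = 0 := by
    intro v
    have hp : 0 < ‖v‖ + 1 := by positivity
    set c := ε / (‖v‖ + 1) with hcdef
    have hcpos : 0 < c := by positivity
    have := hsmall (c • v) (by
      rw [norm_smul, Real.norm_of_nonneg hcpos.le, hcdef, div_mul_eq_mul_div, div_lt_iff₀ hp]
      nlinarith)
    rw [map_smul, inner_smul_left, inner_smul_right] at this
    simpa [hcpos.ne'] using this
  have := hs.inner_map_self_eq_zero.mp hall
  ext1 v
  exact congrArg (fun f => f v) this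

theorem aux_ind {n : ℕ} (ε : ℝ) (hε : 0 < ε) (m : ℕ) :
    ∀ (W : Submodule ℝ (EuclideanSpace ℝ (Fin n) →L[ℝ] EuclideanSpace ℝ (Fin n)))
    (_ : ∀ T ∈ W, IsSelfAdjoint T) (_ : Module.finrank ℝ W ≤ m)
    (x : Fin m → EuclideanSpace ℝ (Fin n)),
    ∃ y : Fin m → EuclideanSpace ℝ (Fin n), (∀ k, ‖x k - y k‖ < ε) ∧
      ∀ T ∈ W, (∀ k, ⟪T (y k), y k⟫_ℝ = 0) → T = 0 := by
  induction m with
  | zero =>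
    intro W _ hd x
    refine ⟨x, fun k => k.elim0, fun T hT _ => ?_⟩
    have : W = ⊥ := Submodule.finrank_eq_zero.mp (Nat.le_zero.mp hd)
    simpa [this] using hT
  | succ m ih =>
    intro W hW hd x
    by_cases hb : W = ⊥
    · refine ⟨x, fun k => by simpa using hε, fun T hT _ => ?_⟩
      simpa [hb] using hT
    obtain ⟨T, hT, hT0⟩ := Submodule.exists_mem_ne_zero_of_ne_bot hb
    obtain ⟨y0, hy0, hy1⟩ := aux_pert T (hW T hT) hT0 (x 0) ε hε
    let φ : (EuclideanSpace ℝ (Fin n) →L[ℝ] EuclideanSpace ℝ (Fin n)) →ₗ[ℝ] ℝ :=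
      { toFun := fun S => ⟪S y0, y0⟫_ℝ
        map_add' := fun S S' => by simp [inner_add_left]
        map_smul' := fun c S => by simp [inner_smul_left] }
    have hlt : W ⊓ LinearMap.ker φ < W := by
      refine lt_of_le_of_ne inf_le_left fun h => hy1 ?_
      have : T ∈ W ⊓ LinearMap.ker φ := by rw [h]; exact hT
      exact this.2
    have hf := Submodule.finrank_lt_finrank_of_lt hlt
    obtain ⟨y, hy, hyT⟩ := ih (W ⊓ LinearMap.ker φ) (fun S hS => hW S hS.1) (by omega)
      (fun k => x k.succ)
    refine ⟨Fin.cons y0 y, ?_, ?_⟩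
    · intro k
      refine Fin.cases ?_ (fun k => ?_) k
      · simpa using hy0
      · simpa using hy k
    · intro S hS h
      refine hyT S ⟨hS, ?_⟩ fun k => ?_
      · exact h 0
      · simpa using h k.succ

theorem aux_dim (n : ℕ) : Module.finrank ℝ (selfAdjoint.submodule ℝ
    (EuclideanSpace ℝ (Fin n) →L[ℝ] EuclideanSpace ℝ (Fin n))) ≤ n * (n + 1) / 2 := by
  let b := EuclideanSpace.basisFun (Fin n) ℝ
  let Φ : (selfAdjoint.submodule ℝ
    (EuclideanSpace ℝ (Fin n) →L[ℝ] EuclideanSpace ℝ (Fin n))) →ₗ[ℝ] (Sym2 (Fin n) → ℝ) :=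
      { toFun := fun S s => ⟪S.1 (b (Quot.out s).1), b (Quot.out s).2⟫_ℝ
        map_add' := fun S S' => by ext s; simp [inner_add_left]
        map_smul' := fun c S => by ext s; simp [inner_smul_left] }
  have hinj : Function.Injective Φ := by
    rw [injective_iff_map_eq_zero]
    rintro ⟨S, hS⟩ h
    have hs : (S : EuclideanSpace ℝ (Fin n) →ₗ[ℝ] EuclideanSpace ℝ (Fin n)).IsSymmetric :=
      ContinuousLinearMap.isSelfAdjoint_iff_isSymmetric.mp hS
    have key : ∀ i j, ⟪S (b i), b j⟫_ℝ = 0 := by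
      intro i j
      have h1 : ⟪S (b (Quot.out s(i, j)).1), b (Quot.out s(i, j)).2⟫_ℝ = 0 := congrFun h s(i, j)
      have h2 : s((Quot.out s(i, j)).1, (Quot.out s(i, j)).2) = s(i, j) := Quot.out_eq s(i, j)
      rcases Sym2.eq_iff.mp h2 with ⟨e1, e2⟩ | ⟨e1, e2⟩
      · rwa [e1, e2] at h1
      · rw [e1, e2] at h1
        have := hs (b i) (b j)
        simp only [ContinuousLinearMap.coe_coe] at this
        rw [this, real_inner_comm, h1]
    apply Subtype.ext
    show S = 0
    have : (S : EuclideanSpace ℝ (Fin n) →ₗ[ℝ] EuclideanSpace ℝ (Fin n)) = 0 := by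
      refine b.toBasis.ext fun i => ?_
      refine InnerProductSpace.ext_inner_right_basis (𝕜 := ℝ) b.toBasis fun j => ?_
      simpa using key i j
    ext1 v
    exact congrArg (fun f => f v) this
  have := LinearMap.finrank_le_finrank_of_injective hinj
  rw [Module.finrank_fintype_fun_eq_card, Sym2.card, Fintype.card_fin, Nat.choose_two_right] at this
  simpa [mul_comm] using this

theorem aux_frame {n m : ℕ} (y : Fin m → EuclideanSpace ℝ (Fin n))
    (h : ∀ T : EuclideanSpace ℝ (Fin n) →L[ℝ] EuclideanSpace ℝ (Fin n),
        IsSelfAdjoint T → (∀ k, ⟪T (y k), y k⟫_ℝ = 0) → T = 0) :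
    ∃ A B : ℝ, 0 < A ∧ A ≤ B ∧ ∀ v : EuclideanSpace ℝ (Fin n),
        A * ‖v‖ ^ 2 ≤ ∑ k, ⟪v, y k⟫_ℝ ^ 2 ∧ ∑ k, ⟪v, y k⟫_ℝ ^ 2 ≤ B * ‖v‖ ^ 2 := by
  let L : EuclideanSpace ℝ (Fin n) →ₗ[ℝ] EuclideanSpace ℝ (Fin m) :=
    { toFun := fun v => WithLp.toLp 2 fun k => ⟪v, y k⟫_ℝ
      map_add' := fun u v => by ext k; simp [inner_add_left]
      map_smul' := fun c v => by ext k; simp [inner_smul_left] }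
  have hL : ∀ v, ‖L v‖ ^ 2 = ∑ k, ⟪v, y k⟫_ℝ ^ 2 := by
    intro v
    rw [EuclideanSpace.real_norm_sq_eq]
    rfl
  have hker : LinearMap.ker L = ⊥ := by
    rw [LinearMap.ker_eq_bot']
    intro v hv
    have hk : ∀ k, ⟪v, y k⟫_ℝ = 0 := fun k => congrArg (fun w : EuclideanSpace ℝ (Fin m) => w k) hv
    let T : EuclideanSpace ℝ (Fin n) →L[ℝ] EuclideanSpace ℝ (Fin n) :=
      (innerSL ℝ v).smulRight v
    have hTT : ∀ u, T u = ⟪v, u⟫_ℝ • v := fun u => rfl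
    have := h T (by
      rw [ContinuousLinearMap.isSelfAdjoint_iff_isSymmetric]
      intro a c
      simp only [ContinuousLinearMap.coe_coe, hTT, inner_smul_left, inner_smul_right]
      rw [real_inner_comm a v]
      simp [mul_comm]) (fun k => by rw [hTT, hk]; simp)
    have h2 : T v = 0 := by rw [this]; rfl
    rw [hTT] at h2
    rcases smul_eq_zero.mp h2 with h3 | h3
    · exact inner_self_eq_zero.mp h3
    · exact h3
  obtain ⟨K, hK, hKL⟩ := L.exists_antilipschitzWith hker
  have hK' : (0 : ℝ) < K := by exact_mod_cast hK
  refine ⟨((K : ℝ) ^ 2)⁻¹, ((K : ℝ) ^ 2)⁻¹ + ∑ k, ‖y k‖ ^ 2, by positivity, ?_, fun v => ⟨?_, ?_⟩⟩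
  · have : 0 ≤ ∑ k, ‖y k‖ ^ 2 := by positivity
    linarith
  · rw [← hL, inv_mul_le_iff₀ (by positivity), ← mul_pow]
    have := hKL.le_mul_dist v 0
    rw [map_zero, dist_zero_right, dist_zero_right] at this
    gcongr
  · rw [add_mul, Finset.sum_mul]
    have h1 : ∑ k, ⟪v, y k⟫_ℝ ^ 2 ≤ ∑ k, ‖y k‖ ^ 2 * ‖v‖ ^ 2 := by
      refine Finset.sum_le_sum fun k _ => ?_
      rw [← mul_pow, ← sq_abs]
      have := abs_real_inner_le_norm v (y k)
      rw [mul_comm] at this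
      gcongr
    have : 0 ≤ ((K : ℝ) ^ 2)⁻¹ * ‖v‖ ^ 2 := by positivity
    linarith

/-- For `m ≥ n(n+1)/2`, the injective `m`-element frames are dense
in the `m`-element frames for `ℝⁿ`: for every `m`-element frame `{x_k}` and
every `δ > 0`, there is an injective `m`-element frame `{y_k}` with
`Σ_k ‖x_k − y_k‖² < δ`. -/
theorem stmt_8 {n m : ℕ} (hm : n * (n + 1) / 2 ≤ m)
    (x : Fin m → EuclideanSpace ℝ (Fin n))
    (hframe : ∃ A B : ℝ, 0 < A ∧ A ≤ B ∧ ∀ v : EuclideanSpace ℝ (Fin n),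
      A * ‖v‖ ^ 2 ≤ ∑ k, ⟪v, x k⟫_ℝ ^ 2 ∧ ∑ k, ⟪v, x k⟫_ℝ ^ 2 ≤ B * ‖v‖ ^ 2)
    (δ : ℝ) (hδ : 0 < δ) :
    ∃ y : Fin m → EuclideanSpace ℝ (Fin n),
      (∃ A B : ℝ, 0 < A ∧ A ≤ B ∧ ∀ v : EuclideanSpace ℝ (Fin n),
        A * ‖v‖ ^ 2 ≤ ∑ k, ⟪v, y k⟫_ℝ ^ 2 ∧ ∑ k, ⟪v, y k⟫_ℝ ^ 2 ≤ B * ‖v‖ ^ 2) ∧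
      (∀ T : EuclideanSpace ℝ (Fin n) →L[ℝ] EuclideanSpace ℝ (Fin n),
        IsSelfAdjoint T → (∀ k, ⟪T (y k), y k⟫_ℝ = 0) → T = 0) ∧
      ∑ k, ‖x k - y k‖ ^ 2 < δ := by
  have hε : 0 < Real.sqrt (δ / (m + 1)) := Real.sqrt_pos.mpr (by positivity)
  obtain ⟨y, hy, hT⟩ := aux_ind (n := n) _ hε m (selfAdjoint.submodule ℝ _) (fun T hT => hT)
    ((aux_dim n).trans hm) x
  have hT' : ∀ T : EuclideanSpace ℝ (Fin n) →L[ℝ] EuclideanSpace ℝ (Fin n),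
        IsSelfAdjoint T → (∀ k, ⟪T (y k), y k⟫_ℝ = 0) → T = 0 := fun T h => hT T h
  refine ⟨y, aux_frame y hT', hT', ?_⟩
  have h1 : ∑ k, ‖x k - y k‖ ^ 2 ≤ ∑ _k : Fin m, δ / (m + 1) := by
    refine Finset.sum_le_sum fun k _ => ?_
    rw [← Real.sq_sqrt (show 0 ≤ δ / ((m : ℝ) + 1) by positivity)]
    have := (hy k).le
    gcongr
  refine h1.trans_lt ?_
  rw [Finset.sum_const, Finset.card_univ, Fintype.card_fin, nsmul_eq_mul, mul_div_assoc',
    div_lt_iff₀ (by positivity)]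
  linarith
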